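/- arXiv:2412.20609 — 2 statements merged into one kernel-verified Lean document; each statement's English description precedes it below -/
import Mathlib

section
/- Let R be either L or H, and let S be a nonempty proper subset of R with S ⊆ C_R(m) for some monic quadratic m ∈ ℤ[x]. Let r(x) = γ₁x + γ₀ ∈ Int(S,R) with γ₀, γ₁ ∈ 𝔻. (a) If R = L and 2γ₁ ∈ L, then r ∈ Int(S*,L). (b) If R = H and γ₁(1+i) ∈ H, then r ∈ Int(S*,H). -/
noncomputable section

open Polynomial

abbrev 𝔻 : Type := Quaternion ℚ

def qi : 𝔻 := QuaternionAlgebra.mk 0 1 0 0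
def qj : 𝔻 := QuaternionAlgebra.mk 0 0 1 0
def qk : 𝔻 := QuaternionAlgebra.mk 0 0 0 1

def isIntQ (q : ℚ) : Prop := ∃ z : ℤ, q = (z : ℚ)
def isHalfOddQ (q : ℚ) : Prop := ∃ z : ℤ, q = (z : ℚ) + 1/2

def Lip : Set 𝔻 :=
  {α | isIntQ α.re ∧ isIntQ α.imI ∧ isIntQ α.imJ ∧ isIntQ α.imK}

def HurOff : Set 𝔻 :=
  {α | isHalfOddQ α.re ∧ isHalfOddQ α.imI ∧ isHalfOddQ α.imJ ∧ isHalfOddQ α.imK}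

def Hur : Set 𝔻 := Lip ∪ HurOff

def qnorm (α : 𝔻) : ℚ := α.re ^ 2 + α.imI ^ 2 + α.imJ ^ 2 + α.imK ^ 2

def minPoly (α : 𝔻) : Polynomial ℚ :=
  if α.imI = 0 ∧ α.imJ = 0 ∧ α.imK = 0 then X - C α.re
  else X ^ 2 - C (2 * α.re) * X + C (qnorm α)

def classOf (R : Set 𝔻) (m : Polynomial ℤ) : Set 𝔻 :=
  {α | α ∈ R ∧ minPoly α = m.map (Int.castRingHom ℚ)}

def IntPolys (S R : Set 𝔻) : Set (Polynomial 𝔻) :=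
  {f | ∀ α ∈ S, f.eval α ∈ R}

def IsRingset (S R : Set 𝔻) : Prop :=
  ∀ f ∈ IntPolys S R, ∀ g ∈ IntPolys S R, f * g ∈ IntPolys S R

def transSet (S : Set 𝔻) (a : ℤ) : Set 𝔻 := (fun α => α + (a : 𝔻)) '' S

def scaleSet (n : ℤ) (R : Set 𝔻) : Set 𝔻 := (fun α => (n : 𝔻) * α) '' R

def IsReducedIn (S R : Set 𝔻) : Prop :=
  (∃ m : Polynomial ℤ, m.Monic ∧ m.natDegree = 2 ∧ S ⊆ classOf R m) ∧
  (∀ a n : ℤ, 2 ≤ n → ¬ (transSet S a ⊆ scaleSet n R))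

def diffs (S : Set 𝔻) : Set 𝔻 := {δ | ∃ α ∈ S, ∃ β ∈ S, δ = α - β}

def normsOf (S : Set 𝔻) : Set ℤ := {n : ℤ | ∃ δ ∈ diffs S, (n : ℚ) = qnorm δ}

def gam (S : Set 𝔻) : ℕ := sSup {g : ℕ | ∀ t ∈ normsOf S, (g : ℤ) ∣ t}

def starSet (S R : Set 𝔻) : Set 𝔻 :=
  {β | ∃ α ∈ S, ∃ u v : 𝔻, u ∈ R ∧ v ∈ R ∧ u * v = 1 ∧ v * u = 1 ∧ β = u * α * v}

def idealGen (R : Set 𝔻) (x : 𝔻) : Set 𝔻 :=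
  {β | ∃ n : ℕ, ∃ a b : Fin n → 𝔻, (∀ k, a k ∈ R) ∧ (∀ k, b k ∈ R) ∧ β = ∑ k, a k * x * b k}

theorem exists_quaternion_of_coords (w x y z : ℚ) :
    ∃ α : 𝔻, α.re = w ∧ α.imI = x ∧ α.imJ = y ∧ α.imK = z :=
  ⟨⟨w, x, y, z⟩, rfl, rfl, rfl, rfl⟩

@[simp] theorem qi_re : qi.re = 0 := rfl
@[simp] theorem qi_imI : qi.imI = 1 := rfl
@[simp] theorem qi_imJ : qi.imJ = 0 := rfl
@[simp] theorem qi_imK : qi.imK = 0 := rfl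

theorem Lip.add_mem {α β : 𝔻} (hα : α ∈ Lip) (hβ : β ∈ Lip) : α + β ∈ Lip := by
  obtain ⟨⟨a, ha⟩, ⟨b, hb⟩, ⟨c, hc⟩, ⟨d, hd⟩⟩ := hα
  obtain ⟨⟨a', ha'⟩, ⟨b', hb'⟩, ⟨c', hc'⟩, ⟨d', hd'⟩⟩ := hβ
  exact ⟨⟨a + a', by simp [ha, ha']⟩, ⟨b + b', by simp [hb, hb']⟩,
    ⟨c + c', by simp [hc, hc']⟩, ⟨d + d', by simp [hd, hd']⟩⟩

theorem Lip.mul_mem {α β : 𝔻} (hα : α ∈ Lip) (hβ : β ∈ Lip) : α * β ∈ Lip := by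
  obtain ⟨⟨a, ha⟩, ⟨b, hb⟩, ⟨c, hc⟩, ⟨d, hd⟩⟩ := hα
  obtain ⟨⟨a', ha'⟩, ⟨b', hb'⟩, ⟨c', hc'⟩, ⟨d', hd'⟩⟩ := hβ
  refine ⟨⟨a * a' - b * b' - c * c' - d * d', ?_⟩, ⟨a * b' + b * a' + c * d' - d * c', ?_⟩,
    ⟨a * c' - b * d' + c * a' + d * b', ?_⟩, ⟨a * d' + b * c' - c * b' + d * a', ?_⟩⟩ <;>
  simp [ha', hb', hc', hd', ha, hb, hc, hd]

/-- The ring of Lipschitz quaternions is commutative modulo `2`. -/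
theorem Lip.exists_commutator_eq_two_mul {α β : 𝔻} (hα : α ∈ Lip) (hβ : β ∈ Lip) :
    ∃ δ ∈ Lip, α * β - β * α = 2 * δ := by
  obtain ⟨⟨a, ha⟩, ⟨b, hb⟩, ⟨c, hc⟩, ⟨d, hd⟩⟩ := hα
  obtain ⟨⟨a', ha'⟩, ⟨b', hb'⟩, ⟨c', hc'⟩, ⟨d', hd'⟩⟩ := hβ
  obtain ⟨δ, hw, hx, hy, hz⟩ :=
    exists_quaternion_of_coords 0 (c * d' - d * c') (d * b' - b * d') (b * c' - c * b')
  refine ⟨δ, ⟨⟨0, by simp [hw]⟩, ⟨c * d' - d * c', by simp [hx]⟩,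
    ⟨d * b' - b * d', by simp [hy]⟩, ⟨b * c' - c * b', by simp [hz]⟩⟩, ?_⟩
  rw [two_mul]
  ext <;> simp [hw, hx, hy, hz, ha', hb', hc', hd', ha, hb, hc, hd] <;> ring

/-- The Hurwitz quaternions are the integer combinations of `1`, `i`, `j`, `k` and
`(1 + i + j + k) / 2`. -/
theorem mem_Hur_iff {α : 𝔻} : α ∈ Hur ↔ ∃ a b c d e : ℤ,
    α.re = a + e / 2 ∧ α.imI = b + e / 2 ∧ α.imJ = c + e / 2 ∧ α.imK = d + e / 2 := by
  constructor
  · rintro (⟨⟨a, ha⟩, ⟨b, hb⟩, ⟨c, hc⟩, ⟨d, hd⟩⟩ | ⟨⟨a, ha⟩, ⟨b, hb⟩, ⟨c, hc⟩, ⟨d, hd⟩⟩)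
    · exact ⟨a, b, c, d, 0, by simp [ha, hb, hc, hd]⟩
    · exact ⟨a, b, c, d, 1, by simp [ha, hb, hc, hd]⟩
  · rintro ⟨a, b, c, d, e, ha, hb, hc, hd⟩
    obtain ⟨f, rfl | rfl⟩ := Int.even_or_odd' e
    · refine Or.inl ⟨⟨a + f, ?_⟩, ⟨b + f, ?_⟩, ⟨c + f, ?_⟩, ⟨d + f, ?_⟩⟩ <;>
      simp [ha, hb, hc, hd]
    · refine Or.inr ⟨⟨a + f, ?_⟩, ⟨b + f, ?_⟩, ⟨c + f, ?_⟩, ⟨d + f, ?_⟩⟩ <;>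
      simp only [ha, hb, hc, hd] <;> push_cast <;> ring

theorem Hur.add_mem {α β : 𝔻} (hα : α ∈ Hur) (hβ : β ∈ Hur) : α + β ∈ Hur := by
  rw [mem_Hur_iff] at *
  obtain ⟨a, b, c, d, e, ha, hb, hc, hd⟩ := hα
  obtain ⟨a', b', c', d', e', ha', hb', hc', hd'⟩ := hβ
  refine ⟨a + a', b + b', c + c', d + d', e + e', ?_, ?_, ?_, ?_⟩ <;>
  simp [ha', hb', hc', hd', ha, hb, hc, hd] <;> ring

theorem Hur.mul_mem {α β : 𝔻} (hα : α ∈ Hur) (hβ : β ∈ Hur) : α * β ∈ Hur := by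
  rw [mem_Hur_iff] at *
  obtain ⟨a, b, c, d, e, ha, hb, hc, hd⟩ := hα
  obtain ⟨a', b', c', d', e', ha', hb', hc', hd'⟩ := hβ
  refine ⟨a * a' - b * b' - c * c' - d * d' - e * (b' + c' + d') - e' * (b + c + d) - e * e',
    a * b' + b * a' + c * d' - d * c' - e * c' - e' * d,
    a * c' - b * d' + c * a' + d * b' - e * d' - e' * b,
    a * d' + b * c' - c * b' + d * a' - e * b' - e' * c,
    e * (a' + b' + c' + d') + e' * (a + b + c + d) + e * e', ?_, ?_, ?_, ?_⟩ <;>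
  simp [ha', hb', hc', hd', ha, hb, hc, hd] <;> ring

/-- The ring of Hurwitz quaternions is commutative modulo `1 + i`. -/
theorem Hur.exists_commutator_eq_one_add_qi_mul {α β : 𝔻} (hα : α ∈ Hur) (hβ : β ∈ Hur) :
    ∃ δ ∈ Hur, α * β - β * α = (1 + qi) * δ := by
  rw [mem_Hur_iff] at hα hβ
  obtain ⟨a, b, c, d, e, ha, hb, hc, hd⟩ := hα
  obtain ⟨a', b', c', d', e', ha', hb', hc', hd'⟩ := hβ
  let x : ℤ := 2 * (c * d' - d * c') + (c * e' + e * d' - d * e' - e * c')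
  let y : ℤ := d * b' - b * d' + (b * c' - c * b') - (c * d' - d * c') +
    (d * e' - e * d' + e * c' - c * e')
  let z : ℤ := b * c' - c * b' - (d * b' - b * d') - (c * d' - d * c') +
    (b * e' + e * c' - c * e' - e * b')
  obtain ⟨δ, hδre, hδi, hδj, hδk⟩ :=
    exists_quaternion_of_coords (x / 2) (x / 2) (y + x / 2) (z + x / 2)
  refine ⟨δ, mem_Hur_iff.2 ⟨0, 0, y, z, x, by simp [hδre, hδi, hδj, hδk]⟩, ?_⟩
  rw [add_mul, one_mul]
  ext <;> simp [hδre, hδi, hδj, hδk, x, y, z, ha', hb', hc', hd', ha, hb, hc, hd] <;> ring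

/-- If commutators in `R` lie in `ε R` and `γ₁ ε ∈ R`, then a linear polynomial that is
`R`-valued on `S` is `R`-valued on all conjugates of elements of `S` by units of `R`. -/
theorem linear_mem_IntPolys_starSet {R S : Set 𝔻} {ε γ₀ γ₁ : 𝔻} (hSR : S ⊆ R)
    (hadd : ∀ {α β : 𝔻}, α ∈ R → β ∈ R → α + β ∈ R)
    (hmul : ∀ {α β : 𝔻}, α ∈ R → β ∈ R → α * β ∈ R)
    (hcomm : ∀ {α β : 𝔻}, α ∈ R → β ∈ R → ∃ δ ∈ R, α * β - β * α = ε * δ)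
    (hε : γ₁ * ε ∈ R) (hr : C γ₁ * X + C γ₀ ∈ IntPolys S R) :
    C γ₁ * X + C γ₀ ∈ IntPolys (starSet S R) R := by
  rintro _ ⟨α, hα, u, v, hu, hv, huv, -, rfl⟩
  obtain ⟨δ, hδ, h⟩ := hcomm hu (hSR hα)
  have hconj : u * α * v = α + ε * δ * v := by
    rw [← h, sub_mul, mul_assoc α u v, huv, mul_one, add_sub_cancel]
  have hrα := hr α hα
  simp only [eval_add, eval_C_mul, eval_X, eval_C] at hrα ⊢
  have heq : γ₁ * (u * α * v) + γ₀ = γ₁ * α + γ₀ + γ₁ * ε * δ * v := by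
    rw [hconj]
    noncomm_ring
  rw [heq]
  exact hadd hrα (hmul (hmul hε hδ) hv)

/-- Sufficient conditions for a linear polynomial in Int(S,R) to be in Int(S*,R). -/
theorem stmt_12 (R : Set 𝔻) (hR : R = Lip ∨ R = Hur)
    (S : Set 𝔻) (hne : S.Nonempty) (hsub : S ⊂ R)
    (m : Polynomial ℤ) (hm : m.Monic) (hdeg : m.natDegree = 2)
    (hcls : S ⊆ classOf R m)
    (γ₀ γ₁ : 𝔻) (hr : (C γ₁ * X + C γ₀) ∈ IntPolys S R) :
    ((R = Lip → 2 * γ₁ ∈ Lip →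
        (C γ₁ * X + C γ₀) ∈ IntPolys (starSet S Lip) Lip) ∧
     (R = Hur → γ₁ * (1 + qi) ∈ Hur →
        (C γ₁ * X + C γ₀) ∈ IntPolys (starSet S Hur) Hur)) := by
  refine ⟨?_, ?_⟩
  · rintro rfl hγ
    refine linear_mem_IntPolys_starSet hsub.subset Lip.add_mem Lip.mul_mem
      Lip.exists_commutator_eq_two_mul ?_ hr
    rwa [mul_two, ← two_mul]
  · rintro rfl hγ
    exact linear_mem_IntPolys_starSet hsub.subset Hur.add_mem Hur.mul_mem
      Hur.exists_commutator_eq_one_add_qi_mul hγ hr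
end
end

section
/- Let R be either L or H and let S be a reduced proper subset of R. (1) If Γ(S) = 1, then S is a ringset of R. (2) If Γ(S) = 2, then S is a ringset of R. (3) If R = L and Γ(S) = 4, then S is a ringset of L. -/
noncomputable section

open Polynomial

lemma quaternion_ext {α β : 𝔻} (hre : α.re = β.re) (hI : α.imI = β.imI) (hJ : α.imJ = β.imJ)
    (hK : α.imK = β.imK) : α = β :=
  Quaternion.ext α β hre hI hJ hK

/-- The quaternion `a + b i + c j + d k`. -/
def quat (a b c d : ℚ) : 𝔻 := ⟨a, b, c, d⟩

@[simp] lemma quat_re (a b c d : ℚ) : (quat a b c d).re = a := rfl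
@[simp] lemma quat_imI (a b c d : ℚ) : (quat a b c d).imI = b := rfl
@[simp] lemma quat_imJ (a b c d : ℚ) : (quat a b c d).imJ = c := rfl
@[simp] lemma quat_imK (a b c d : ℚ) : (quat a b c d).imK = d := rfl

lemma zero_eq_quat : (0 : 𝔻) = quat 0 0 0 0 := rfl

lemma one_eq_quat : (1 : 𝔻) = quat 1 0 0 0 := rfl

lemma qi_eq_quat : qi = quat 0 1 0 0 := rfl

lemma two_mul_quat (a b c d : ℚ) : 2 * quat a b c d = quat (2 * a) (2 * b) (2 * c) (2 * d) := by
  rw [two_mul]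
  apply quaternion_ext <;> simp <;> ring

lemma mem_Lip_iff {α : 𝔻} :
    α ∈ Lip ↔ ∃ w x y z : ℤ, α = quat w x y z := by
  constructor
  · rintro ⟨⟨w, hw⟩, ⟨x, hx⟩, ⟨y, hy⟩, ⟨z, hz⟩⟩
    exact ⟨w, x, y, z, quaternion_ext hw hx hy hz⟩
  · rintro ⟨w, x, y, z, rfl⟩
    exact ⟨⟨w, rfl⟩, ⟨x, rfl⟩, ⟨y, rfl⟩, ⟨z, rfl⟩⟩

/-- Coordinates of Hurwitz quaternions in the basis `(1 + i + j + k) / 2, i, j, k`. -/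
def hurwitzMk (t x y z : ℤ) : 𝔻 :=
  quat (t / 2) (t / 2 + x) (t / 2 + y) (t / 2 + z)

lemma mem_Hur_iff_s13 {α : 𝔻} : α ∈ Hur ↔ ∃ t x y z : ℤ, α = hurwitzMk t x y z := by
  constructor
  · rintro (⟨⟨w, hw⟩, ⟨x, hx⟩, ⟨y, hy⟩, ⟨z, hz⟩⟩ | ⟨⟨w, hw⟩, ⟨x, hx⟩, ⟨y, hy⟩, ⟨z, hz⟩⟩)
    · refine ⟨2 * w, x - w, y - w, z - w, quaternion_ext ?_ ?_ ?_ ?_⟩ <;>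
        simp [hurwitzMk, *]
    · refine ⟨2 * w + 1, x - w, y - w, z - w, quaternion_ext ?_ ?_ ?_ ?_⟩ <;>
        simp only [hurwitzMk, hw, hx, hy, hz, quat_re, quat_imI, quat_imJ, quat_imK] <;> push_cast <;> ring
  · rintro ⟨t, x, y, z, rfl⟩
    rcases Int.even_or_odd' t with ⟨u, rfl | rfl⟩
    · refine Or.inl ⟨⟨u, ?_⟩, ⟨u + x, ?_⟩, ⟨u + y, ?_⟩, ⟨u + z, ?_⟩⟩ <;>
        simp only [hurwitzMk, quat_re, quat_imI, quat_imJ, quat_imK] <;> push_cast <;> ring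
    · refine Or.inr ⟨⟨u, ?_⟩, ⟨u + x, ?_⟩, ⟨u + y, ?_⟩, ⟨u + z, ?_⟩⟩ <;>
        simp only [hurwitzMk, quat_re, quat_imI, quat_imJ, quat_imK] <;> push_cast <;> ring

/-- The Lipschitz quaternions as a subring. -/
def lipschitzSubring : Subring 𝔻 where
  carrier := Lip
  zero_mem' := mem_Lip_iff.2 ⟨0, 0, 0, 0, by simp [zero_eq_quat]⟩
  one_mem' := mem_Lip_iff.2 ⟨1, 0, 0, 0, by simp [one_eq_quat]⟩
  neg_mem' := by
    intro α hα
    obtain ⟨w, x, y, z, rfl⟩ := mem_Lip_iff.1 hα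
    exact mem_Lip_iff.2 ⟨-w, -x, -y, -z, by apply quaternion_ext <;> simp⟩
  add_mem' := by
    intro α β hα hβ
    obtain ⟨w, x, y, z, rfl⟩ := mem_Lip_iff.1 hα
    obtain ⟨w', x', y', z', rfl⟩ := mem_Lip_iff.1 hβ
    exact mem_Lip_iff.2 ⟨w + w', x + x', y + y', z + z', by apply quaternion_ext <;> simp⟩
  mul_mem' := by
    intro α β hα hβ
    obtain ⟨w, x, y, z, rfl⟩ := mem_Lip_iff.1 hα
    obtain ⟨w', x', y', z', rfl⟩ := mem_Lip_iff.1 hβ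
    refine mem_Lip_iff.2 ⟨w * w' - x * x' - y * y' - z * z', w * x' + x * w' + y * z' - z * y',
      w * y' - x * z' + y * w' + z * x', w * z' + x * y' - y * x' + z * w', ?_⟩
    apply quaternion_ext <;> simp

/-- The Hurwitz quaternions as a subring. -/
def hurwitzSubring : Subring 𝔻 where
  carrier := Hur
  zero_mem' := mem_Hur_iff_s13.2 ⟨0, 0, 0, 0, by simp [hurwitzMk, zero_eq_quat]⟩
  one_mem' := mem_Hur_iff_s13.2 ⟨2, -1, -1, -1, by simp [hurwitzMk, one_eq_quat]⟩
  neg_mem' := by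
    intro α hα
    obtain ⟨t, x, y, z, rfl⟩ := mem_Hur_iff_s13.1 hα
    exact mem_Hur_iff_s13.2 ⟨-t, -x, -y, -z, by apply quaternion_ext <;> simp [hurwitzMk] <;> ring⟩
  add_mem' := by
    intro α β hα hβ
    obtain ⟨t, x, y, z, rfl⟩ := mem_Hur_iff_s13.1 hα
    obtain ⟨t', x', y', z', rfl⟩ := mem_Hur_iff_s13.1 hβ
    exact mem_Hur_iff_s13.2 ⟨t + t', x + x', y + y', z + z', by
      apply quaternion_ext <;> simp [hurwitzMk] <;> ring⟩
  mul_mem' := by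
    intro α β hα hβ
    obtain ⟨t, x, y, z, rfl⟩ := mem_Hur_iff_s13.1 hα
    obtain ⟨t', x', y', z', rfl⟩ := mem_Hur_iff_s13.1 hβ
    refine mem_Hur_iff_s13.2
      ⟨-(t * t') - (t * (x' + y' + z') + (x + y + z) * t') - 2 * (x * x' + y * y' + z * z'),
      t * t' + t * x' + x * t' + t * z' + y * t' + y * z' - z * y' + (x * x' + y * y' + z * z'),
      t * t' + t * y' + y * t' + t * x' + z * t' + z * x' - x * z' + (x * x' + y * y' + z * z'),
      t * t' + t * z' + z * t' + t * y' + x * t' + x * y' - y * x' + (x * x' + y * y' + z * z'),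
      ?_⟩
    apply quaternion_ext <;> simp [hurwitzMk] <;> ring

lemma star_mem_Lip {α : 𝔻} (hα : α ∈ Lip) : star α ∈ Lip := by
  obtain ⟨w, x, y, z, rfl⟩ := mem_Lip_iff.1 hα
  exact mem_Lip_iff.2 ⟨w, -x, -y, -z, by apply quaternion_ext <;> simp⟩

lemma star_mem_Hur {α : 𝔻} (hα : α ∈ Hur) : star α ∈ Hur := by
  obtain ⟨t, x, y, z, rfl⟩ := mem_Hur_iff_s13.1 hα
  exact mem_Hur_iff_s13.2 ⟨t, -x - t, -y - t, -z - t, by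
    apply quaternion_ext <;> simp [hurwitzMk] <;> ring⟩

lemma Lip_subset_Hur : Lip ⊆ Hur := Set.subset_union_left

lemma qnorm_hurwitzMk (t x y z : ℤ) :
    qnorm (hurwitzMk t x y z) = ((t ^ 2 + t * (x + y + z) + x ^ 2 + y ^ 2 + z ^ 2 : ℤ) : ℚ) := by
  simp only [hurwitzMk, qnorm, quat_re, quat_imI, quat_imJ, quat_imK]
  push_cast
  ring

lemma exists_int_qnorm {α : 𝔻} (hα : α ∈ Hur) : ∃ n : ℤ, (n : ℚ) = qnorm α := by
  obtain ⟨t, x, y, z, rfl⟩ := mem_Hur_iff_s13.1 hα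
  exact ⟨_, (qnorm_hurwitzMk t x y z).symm⟩

lemma mul_star_eq_qnorm (α : 𝔻) : α * star α = ((qnorm α : ℚ) : 𝔻) := by
  apply quaternion_ext <;> simp [qnorm] <;> ring

lemma qnorm_mul (α β : 𝔻) : qnorm (α * β) = qnorm α * qnorm β := by
  simp [qnorm]
  ring

lemma eval_mul_eq_eval_mul_C (f g : 𝔻[X]) (α : 𝔻) :
    (f * g).eval α = (f * C (g.eval α)).eval α := by
  induction f using Polynomial.induction_on' with
  | add p q hp hq => simp only [add_mul, eval_add, hp, hq]
  | monomial n c =>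
    simp only [← C_mul_X_pow_eq_monomial, mul_assoc, X_pow_mul, eval_C_mul, eval_mul_X_pow, eval_C]

lemma exists_pow_eq_linear (p q : ℤ) (n : ℕ) :
    ∃ u v : ℤ, ∀ α : 𝔻, α ^ 2 = (p : 𝔻) * α + (q : 𝔻) → α ^ n = (u : 𝔻) * α + (v : 𝔻) := by
  induction n with
  | zero => exact ⟨0, 1, fun α _ => by simp⟩
  | succ n ih =>
    obtain ⟨u, v, h⟩ := ih
    refine ⟨u * p + v, u * q, fun α hα => ?_⟩
    rw [pow_succ, h α hα, add_mul, mul_assoc, ← pow_two, hα]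
    push_cast
    noncomm_ring

/-- Remainder of `f` modulo a central quadratic polynomial, evaluated with a twist by `γ`. -/
lemma exists_eval_eq_linear (p q : ℤ) (f : 𝔻[X]) :
    ∃ a b : 𝔻, ∀ α γ : 𝔻, α ^ 2 = (p : 𝔻) * α + (q : 𝔻) →
      (f * C γ).eval α = a * γ * α + b * γ := by
  induction f using Polynomial.induction_on' with
  | add f g hf hg =>
    obtain ⟨a, b, h⟩ := hf
    obtain ⟨a', b', h'⟩ := hg
    refine ⟨a + a', b + b', fun α γ hα => ?_⟩
    rw [add_mul, eval_add, h α γ hα, h' α γ hα]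
    noncomm_ring
  | monomial n c =>
    obtain ⟨u, v, h⟩ := exists_pow_eq_linear p q n
    refine ⟨c * u, c * v, fun α γ hα => ?_⟩
    rw [← C_mul_X_pow_eq_monomial, mul_assoc, X_pow_mul, eval_C_mul, eval_mul_X_pow, eval_C,
      h α hα, mul_add, ← mul_assoc γ, mul_assoc c, mul_assoc c, ← (Int.cast_commute u γ).eq,
      ← (Int.cast_commute v γ).eq]
    noncomm_ring

lemma isRingset_of_commutator (R : Subring 𝔻) (S : Set 𝔻) (p q : ℤ)
    (hS : ∀ α ∈ S, α ^ 2 = (p : 𝔻) * α + (q : 𝔻))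
    (hcomm : ∀ a : 𝔻, (∀ δ ∈ diffs S, a * δ ∈ R) →
      ∀ α ∈ S, ∀ γ ∈ R, a * (γ * α - α * γ) ∈ R) :
    IsRingset S (R : Set 𝔻) := by
  intro f hf g hg α hα
  obtain ⟨a, b, hab⟩ := exists_eval_eq_linear p q f
  have heval : ∀ β ∈ S, f.eval β = a * β + b := fun β hβ => by
    simpa using hab β 1 (hS β hβ)
  have hdiff : ∀ δ ∈ diffs S, a * δ ∈ R := by
    rintro _ ⟨β, hβ, β', hβ', rfl⟩
    have : a * (β - β') = f.eval β - f.eval β' := by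
      rw [heval β hβ, heval β' hβ']
      noncomm_ring
    rw [this]
    exact R.sub_mem (hf β hβ) (hf β' hβ')
  have key : (f * g).eval α =
      a * (g.eval α * α - α * g.eval α) + f.eval α * g.eval α := by
    rw [eval_mul_eq_eval_mul_C, hab α _ (hS α hα), heval α hα]
    noncomm_ring
  rw [key]
  exact R.add_mem (hcomm a hdiff α hα _ (hg α hα)) (R.mul_mem (hf α hα) (hg α hα))

lemma exists_trace_norm {R S : Set 𝔻} (hred : IsReducedIn S R) :
    ∃ p q : ℤ, ∀ α ∈ S, 2 * α.re = p ∧ α ^ 2 = (p : 𝔻) * α + (q : 𝔻) := by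
  obtain ⟨⟨m, hm, hdeg, hS⟩, -⟩ := hred
  refine ⟨-m.coeff 1, -m.coeff 0, fun α hα => ?_⟩
  have h := (hS hα).2
  have hd : (minPoly α).natDegree = 2 := by
    rw [h, hm.natDegree_map, hdeg]
  unfold minPoly at h hd
  split_ifs at h hd with hc
  · rw [natDegree_X_sub_C] at hd
    omega
  have h1 : 2 * α.re = -(m.coeff 1 : ℚ) := by
    have := congrArg (fun r => coeff r 1) h
    simp [coeff_C] at this
    linarith
  have h0 : qnorm α = (m.coeff 0 : ℚ) := by
    have := congrArg (fun r => coeff r 0) h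
    simpa using this
  refine ⟨by rw [h1]; push_cast; ring, ?_⟩
  push_cast
  have e1 : ((m.coeff 1 : ℤ) : 𝔻) = ((-(2 * α.re) : ℚ) : 𝔻) := by
    rw [h1, neg_neg]; norm_cast
  have e0 : ((m.coeff 0 : ℤ) : 𝔻) = ((qnorm α : ℚ) : 𝔻) := by
    rw [h0]; norm_cast
  rw [e1, e0]
  apply quaternion_ext <;> simp [qnorm, pow_two] <;> ring

lemma gam_dvd_norm {S : Set 𝔻} (h : gam S ≠ 0) : ∀ t ∈ normsOf S, ((gam S : ℕ) : ℤ) ∣ t := by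
  have hb : BddAbove {g : ℕ | ∀ t ∈ normsOf S, (g : ℤ) ∣ t} := by
    by_contra hb
    exact h (Nat.sSup_of_not_bddAbove hb)
  exact Nat.sSup_mem ⟨1, fun t _ => by simp⟩ hb

lemma dvd_gam {S : Set 𝔻} (h : gam S ≠ 0) {d : ℕ} (hd : ∀ t ∈ normsOf S, (d : ℤ) ∣ t) :
    d ∣ gam S := by
  have hb : BddAbove {g : ℕ | ∀ t ∈ normsOf S, (g : ℤ) ∣ t} := by
    by_contra hb
    exact h (Nat.sSup_of_not_bddAbove hb)
  rcases Nat.eq_zero_or_pos d with rfl | hpos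
  · have : gam S + 1 ≤ gam S := le_csSup hb fun t ht => by
      have := hd t ht
      simp at this
      simp [this]
    omega
  · have hle : Nat.lcm d (gam S) ≤ gam S := le_csSup hb fun t ht =>
      Int.natCast_dvd.2 (Nat.lcm_dvd (Int.natCast_dvd.1 (hd t ht))
        (Int.natCast_dvd.1 (gam_dvd_norm h t ht)))
    have heq : Nat.lcm d (gam S) = gam S :=
      le_antisymm hle (Nat.le_of_dvd (Nat.lcm_pos hpos (Nat.pos_of_ne_zero h))
        (Nat.dvd_lcm_right _ _))
    exact heq ▸ Nat.dvd_lcm_left d (gam S)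

lemma exists_norm_not_dvd {S : Set 𝔻} (h : gam S ≠ 0) :
    ∃ t ∈ normsOf S, ¬ (2 * (gam S : ℤ)) ∣ t := by
  by_contra! hc
  have h2 := Nat.le_of_dvd (Nat.pos_of_ne_zero h)
    (dvd_gam h (d := 2 * gam S) (by exact_mod_cast hc))
  omega

/-- The integers `n` with `a * n ∈ R`. -/
def denominators (R : Subring 𝔻) (a : 𝔻) : AddSubgroup ℤ where
  carrier := {n | a * (n : 𝔻) ∈ R}
  zero_mem' := by simp
  add_mem' := by
    intro m n hm hn
    simpa [mul_add] using R.add_mem hm hn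
  neg_mem' := by
    intro n hn
    simpa using R.neg_mem hn

lemma mem_denominators {R : Subring 𝔻} {a : 𝔻} {n : ℤ} :
    n ∈ denominators R a ↔ a * (n : 𝔻) ∈ R := Iff.rfl

lemma mul_gam_mem {R : Subring 𝔻} (hstar : ∀ α ∈ R, star α ∈ R) {S : Set 𝔻}
    (hS : S ⊆ R) (h : gam S ≠ 0) {a : 𝔻} (ha : ∀ δ ∈ diffs S, a * δ ∈ R) :
    a * (gam S : 𝔻) ∈ R := by
  obtain ⟨d, hd⟩ := Int.subgroup_cyclic (denominators R a)
  have hmem : ∀ n : ℤ, a * (n : 𝔻) ∈ R ↔ d ∣ n := fun n => by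
    rw [← mem_denominators, hd, AddSubgroup.mem_closure_singleton]
    simp only [dvd_def, smul_eq_mul, mul_comm, eq_comm]
  have hdvd : ∀ t ∈ normsOf S, (d.natAbs : ℤ) ∣ t := by
    rintro t ⟨δ, hδ, ht⟩
    rw [Int.natAbs_dvd, ← hmem]
    have hδR : δ ∈ R := by
      obtain ⟨α, hα, β, hβ, rfl⟩ := hδ
      exact R.sub_mem (hS hα) (hS hβ)
    have : ((t : ℤ) : 𝔻) = δ * star δ := by
      rw [mul_star_eq_qnorm, ← ht]; norm_cast
    rw [this, ← mul_assoc]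
    exact R.mul_mem (ha δ hδ) (hstar δ hδR)
  have := (hmem (gam S)).2 (Int.natAbs_dvd.1 (Int.natCast_dvd_natCast.2 (dvd_gam h hdvd)))
  exact_mod_cast this

lemma mem_of_mul_odd_mem {R : Subring 𝔻} {a : 𝔻} {n : ℤ} (hn : Odd n)
    (h2 : a * 2 ∈ R) (h : a * (n : 𝔻) ∈ R) : a ∈ R := by
  obtain ⟨k, rfl⟩ := hn
  have : a = a * ((2 * k + 1 : ℤ) : 𝔻) - a * 2 * (k : 𝔻) := by
    push_cast
    noncomm_ring
  rw [this]
  exact R.sub_mem h (R.mul_mem h2 (intCast_mem R k))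

lemma mem_of_mul_mem_of_odd_norm {R : Subring 𝔻} (hstar : ∀ α ∈ R, star α ∈ R) {a ε : 𝔻}
    (hε : ε ∈ R) {n : ℤ} (hn : Odd n) (hnorm : (n : ℚ) = qnorm ε)
    (h2 : a * 2 ∈ R) (h : a * ε ∈ R) : a ∈ R := by
  refine mem_of_mul_odd_mem hn h2 ?_
  have : ((n : ℤ) : 𝔻) = ε * star ε := by
    rw [mul_star_eq_qnorm, ← hnorm]; norm_cast
  rw [this, ← mul_assoc]
  exact R.mul_mem h (hstar ε hε)

lemma commutator_mem_two_mul_Lip {α β : 𝔻} (hα : α ∈ Lip) (hβ : β ∈ Lip) :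
    ∃ η ∈ Lip, α * β - β * α = 2 * η := by
  obtain ⟨w, x, y, z, rfl⟩ := mem_Lip_iff.1 hα
  obtain ⟨w', x', y', z', rfl⟩ := mem_Lip_iff.1 hβ
  refine ⟨_, mem_Lip_iff.2 ⟨0, y * z' - z * y', z * x' - x * z', x * y' - y * x', rfl⟩, ?_⟩
  rw [two_mul_quat]
  apply quaternion_ext <;> simp <;> ring

lemma exists_hurwitzMk_factor (t x y z : ℤ) (ht : Even t) (hs : Even (x + y + z)) :
    ∃ ε ∈ Hur, hurwitzMk t x y z = (1 + qi) * ε := by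
  obtain ⟨u, rfl⟩ := ht
  obtain ⟨v, hv⟩ := hs
  obtain rfl : x = 2 * v - y - z := by omega
  refine ⟨_, mem_Hur_iff_s13.2 ⟨2 * u + (2 * v - y - z), -u, y + z - v, z - u - v, rfl⟩, ?_⟩
  apply quaternion_ext <;> simp [hurwitzMk, one_eq_quat, qi_eq_quat] <;> ring

lemma exists_factor_of_even_norm {δ : 𝔻} (hδ : δ ∈ Hur) {n : ℤ} (hn : Even n)
    (hnorm : (n : ℚ) = qnorm δ) : ∃ ε ∈ Hur, δ = (1 + qi) * ε := by
  obtain ⟨t, x, y, z, rfl⟩ := mem_Hur_iff_s13.1 hδ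
  rw [qnorm_hurwitzMk] at hnorm
  rw [Int.cast_injective hnorm] at hn
  have hpar : Even t ∧ Even (x + y + z) := by
    simp only [parity_simps] at hn ⊢
    tauto
  exact exists_hurwitzMk_factor t x y z hpar.1 hpar.2

lemma commutator_mem_mul_Hur {α β : 𝔻} (hα : α ∈ Hur) (hβ : β ∈ Hur) :
    ∃ η ∈ Hur, α * β - β * α = (1 + qi) * η := by
  obtain ⟨t, x, y, z, rfl⟩ := mem_Hur_iff_s13.1 hα
  obtain ⟨t', x', y', z', rfl⟩ := mem_Hur_iff_s13.1 hβ
  have : hurwitzMk t x y z * hurwitzMk t' x' y' z' - hurwitzMk t' x' y' z' * hurwitzMk t x y z =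
      hurwitzMk 0 (t * (z' - y') + t' * (y - z) + 2 * (y * z' - z * y'))
        (t * (x' - z') + t' * (z - x) + 2 * (z * x' - x * z'))
        (t * (y' - x') + t' * (x - y) + 2 * (x * y' - y * x')) := by
    apply quaternion_ext <;> simp [hurwitzMk] <;> ring
  rw [this]
  exact exists_hurwitzMk_factor _ _ _ _ Even.zero
    ⟨y * z' - z * y' + (z * x' - x * z') + (x * y' - y * x'), by ring⟩

lemma exists_half_of_pure_norm_dvd {δ : 𝔻} (hδ : δ ∈ Lip) (hre : δ.re = 0) {n : ℤ} (hn : 4 ∣ n)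
    (hnorm : (n : ℚ) = qnorm δ) : ∃ ε ∈ Lip, δ = 2 * ε := by
  obtain ⟨w, x, y, z, rfl⟩ := mem_Lip_iff.1 hδ
  obtain rfl : w = 0 := by simpa using hre
  have hn' : n = x ^ 2 + y ^ 2 + z ^ 2 := by
    have : (n : ℚ) = ((x ^ 2 + y ^ 2 + z ^ 2 : ℤ) : ℚ) := by
      rw [hnorm]
      simp [qnorm]
    exact_mod_cast this
  rw [hn'] at hn
  have hsq : ∀ s : ℤ, (∃ r, s = 2 * r ∧ s ^ 2 % 4 = 0) ∨ s ^ 2 % 4 = 1 := fun s => by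
    rcases Int.even_or_odd' s with ⟨r, rfl | rfl⟩
    · exact Or.inl ⟨r, rfl, by ring_nf; omega⟩
    · exact Or.inr (by ring_nf; omega)
  obtain ⟨⟨x', rfl⟩, ⟨y', rfl⟩, ⟨z', rfl⟩⟩ : (∃ r, x = 2 * r) ∧ (∃ r, y = 2 * r) ∧
      ∃ r, z = 2 * r := by
    rcases hsq x with ⟨a, ha, hx⟩ | hx <;> rcases hsq y with ⟨b, hb, hy⟩ | hy <;>
      rcases hsq z with ⟨c, hc, hz⟩ | hz <;> first | exact ⟨⟨a, ha⟩, ⟨b, hb⟩, ⟨c, hc⟩⟩ | omega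
  refine ⟨_, mem_Lip_iff.2 ⟨0, x', y', z', rfl⟩, ?_⟩
  rw [two_mul_quat]
  apply quaternion_ext <;> simp

lemma diffs_subset {R : Subring 𝔻} {S : Set 𝔻} (hS : S ⊆ R) : diffs S ⊆ R := by
  rintro _ ⟨α, hα, β, hβ, rfl⟩
  exact R.sub_mem (hS hα) (hS hβ)

lemma isRingset_of_gam_eq_one {R : Subring 𝔻} (hstar : ∀ α ∈ R, star α ∈ R) {S : Set 𝔻}
    (hS : S ⊆ R) (hred : IsReducedIn S R) (h : gam S = 1) : IsRingset S R := by
  obtain ⟨p, q, hpq⟩ := exists_trace_norm hred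
  refine isRingset_of_commutator R S p q (fun α hα => (hpq α hα).2) fun a ha α hα γ hγ => ?_
  have h1 := mul_gam_mem hstar hS (by omega) ha
  rw [h, Nat.cast_one, mul_one] at h1
  exact R.mul_mem h1 (R.sub_mem (R.mul_mem hγ (hS hα)) (R.mul_mem (hS hα) hγ))

lemma isRingset_Lip_of_two_mul_mem {S : Set 𝔻} (hS : S ⊆ Lip) (hred : IsReducedIn S Lip)
    (h : ∀ a : 𝔻, (∀ δ ∈ diffs S, a * δ ∈ Lip) → a * 2 ∈ Lip) : IsRingset S Lip := by
  obtain ⟨p, q, hpq⟩ := exists_trace_norm hred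
  refine isRingset_of_commutator lipschitzSubring S p q (fun α hα => (hpq α hα).2)
    fun a ha α hα γ hγ => ?_
  obtain ⟨η, hη, he⟩ := commutator_mem_two_mul_Lip hγ (hS hα)
  rw [he, ← mul_assoc]
  exact lipschitzSubring.mul_mem (h a ha) hη

lemma isRingset_Lip_of_gam_eq_two {S : Set 𝔻} (hS : S ⊆ Lip) (hred : IsReducedIn S Lip)
    (h : gam S = 2) : IsRingset S Lip := by
  refine isRingset_Lip_of_two_mul_mem hS hred fun a ha => ?_
  have h2 := mul_gam_mem (R := lipschitzSubring) (fun _ => star_mem_Lip) hS (by omega) ha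
  rw [h] at h2
  exact h2

lemma isRingset_Lip_of_gam_eq_four {S : Set 𝔻} (hS : S ⊆ Lip) (hred : IsReducedIn S Lip)
    (h : gam S = 4) : IsRingset S Lip := by
  refine isRingset_Lip_of_two_mul_mem hS hred fun a ha => ?_
  have h0 : gam S ≠ 0 := by omega
  have h4 := mul_gam_mem (R := lipschitzSubring) (fun _ => star_mem_Lip) hS h0 ha
  obtain ⟨t, ht, htn⟩ := exists_norm_not_dvd h0
  have htd := gam_dvd_norm h0 t ht
  rw [h] at h4 htn htd
  obtain ⟨δ, hδ, hnorm⟩ := ht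
  obtain ⟨p, q, hpq⟩ := exists_trace_norm hred
  have hre : δ.re = 0 := by
    obtain ⟨α, hα, β, hβ, rfl⟩ := hδ
    have h1 := (hpq α hα).1
    have h2 := (hpq β hβ).1
    rw [Quaternion.re_sub]
    linarith
  obtain ⟨ε, hε, rfl⟩ := exists_half_of_pure_norm_dvd
    (diffs_subset (R := lipschitzSubring) hS hδ) hre htd hnorm
  obtain ⟨n, hn⟩ := exists_int_qnorm (Lip_subset_Hur hε)
  have htn' : t = 4 * n := by
    have : (t : ℚ) = 4 * n := by
      rw [hnorm, hn, two_mul]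
      simp [qnorm]
      ring
    exact_mod_cast this
  have hodd : Odd n := by
    rw [← Int.not_even_iff_odd]
    rintro ⟨k, rfl⟩
    exact htn ⟨k, by rw [htn']; push_cast; ring⟩
  refine mem_of_mul_mem_of_odd_norm (R := lipschitzSubring) (fun _ => star_mem_Lip) hε hodd hn ?_ ?_
  · have : a * 2 * 2 = a * ((4 : ℕ) : 𝔻) := by
      rw [mul_assoc]; norm_num
    rw [this]
    exact h4
  · rw [mul_assoc]
    exact ha _ hδ

lemma isRingset_Hur_of_gam_eq_two {S : Set 𝔻} (hS : S ⊆ Hur) (hred : IsReducedIn S Hur)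
    (h : gam S = 2) : IsRingset S Hur := by
  obtain ⟨p, q, hpq⟩ := exists_trace_norm hred
  refine isRingset_of_commutator hurwitzSubring S p q (fun α hα => (hpq α hα).2)
    fun a ha α hα γ hγ => ?_
  have h0 : gam S ≠ 0 := by omega
  have h2 : a * (gam S : 𝔻) ∈ hurwitzSubring := mul_gam_mem (fun _ => star_mem_Hur) hS h0 ha
  obtain ⟨t, ht, htn⟩ := exists_norm_not_dvd h0
  have htd := gam_dvd_norm h0 t ht
  rw [h] at h2 htn htd
  obtain ⟨δ, hδ, hnorm⟩ := ht
  obtain ⟨ε, hε, rfl⟩ := exists_factor_of_even_norm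
    (diffs_subset (R := hurwitzSubring) hS hδ) (even_iff_two_dvd.2 htd) hnorm
  obtain ⟨n, hn⟩ := exists_int_qnorm hε
  have htn' : t = 2 * n := by
    have : (t : ℚ) = 2 * n := by
      rw [hnorm, hn, qnorm_mul]
      simp [qnorm, one_eq_quat, qi_eq_quat]
      norm_num
    exact_mod_cast this
  have hodd : Odd n := by
    rw [← Int.not_even_iff_odd]
    rintro ⟨k, rfl⟩
    exact htn ⟨k, by rw [htn']; push_cast; ring⟩
  have hqi : 1 + qi ∈ hurwitzSubring :=
    mem_Hur_iff_s13.2 ⟨2, 0, -1, -1, by apply quaternion_ext <;> simp [hurwitzMk, one_eq_quat, qi_eq_quat]⟩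
  have key : a * (1 + qi) ∈ hurwitzSubring := by
    refine mem_of_mul_mem_of_odd_norm (fun _ => star_mem_Hur) hε hodd hn ?_ ?_
    · have : a * (1 + qi) * 2 = a * ((2 : ℕ) : 𝔻) * (1 + qi) := by
        push_cast
        noncomm_ring
      rw [this]
      exact hurwitzSubring.mul_mem h2 hqi
    · rw [mul_assoc]
      exact ha _ hδ
  obtain ⟨η, hη, he⟩ := commutator_mem_mul_Hur hγ (hS hα)
  rw [he, ← mul_assoc]
  exact hurwitzSubring.mul_mem key hη

/-- Reduced sets with Γ(S) = 1, 2 (or 4 over L) are ringsets. -/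
theorem stmt_13 (R : Set 𝔻) (hR : R = Lip ∨ R = Hur)
    (S : Set 𝔻) (hsub : S ⊂ R) (hred : IsReducedIn S R) :
    (gam S = 1 → IsRingset S R) ∧
    (gam S = 2 → IsRingset S R) ∧
    (R = Lip → gam S = 4 → IsRingset S Lip) := by
  rcases hR with rfl | rfl
  · exact ⟨isRingset_of_gam_eq_one (R := lipschitzSubring) (fun _ => star_mem_Lip) hsub.1 hred,
      isRingset_Lip_of_gam_eq_two hsub.1 hred, fun _ => isRingset_Lip_of_gam_eq_four hsub.1 hred⟩
  · refine ⟨isRingset_of_gam_eq_one (R := hurwitzSubring) (fun _ => star_mem_Hur) hsub.1 hred,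
      isRingset_Hur_of_gam_eq_two hsub.1 hred, fun hR => ?_⟩
    rw [hR] at hsub hred
    exact isRingset_Lip_of_gam_eq_four hsub.1 hred
end
end
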